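/- arXiv:math/0210320 — 10 statements merged into one kernel-verified Lean document; each statement's English description precedes it below -/
import Mathlib

section
/- Generalized linear Numerov formula with sixth-order local truncation error: as h → 0, the quantity T₀(h)·y₀ − T₊(h)·y₊ − T₋(h)·y₋ − (h⁶/240)·(y⁽⁶⁾₀ + 3·g₀·y⁽⁵⁾₀), viewed as a function of h, is O(h⁸). -/
open Asymptotics Filter Topology

/-- Taylor's theorem at an interior point: a `Cⁿ` function agrees with its Taylor polynomial of
degree `n - 1` up to `O(hⁿ)`. -/
theorem ContDiffOn.sub_taylor_isBigO {φ : ℝ → ℝ} {x₀ lo hi : ℝ} {n : ℕ}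
    (hx : x₀ ∈ Set.Ioo lo hi) (hφ : ContDiffOn ℝ n φ (Set.Ioo lo hi)) :
    (fun h : ℝ => φ (x₀ + h) -
      ∑ k ∈ Finset.range n, iteratedDeriv k φ x₀ / (k.factorial : ℝ) * h ^ k)
      =O[𝓝 0] (fun h : ℝ => h ^ n) := by
  have taylor := taylor_isLittleO (convex_Ioo lo hi) hx hφ
  rw [isOpen_Ioo.nhdsWithin_eq hx] at taylor
  have shift : Tendsto (fun h : ℝ => x₀ + h) (𝓝 0) (𝓝 x₀) := by
    simpa using (continuous_const_add x₀).tendsto 0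
  have main := (taylor.comp_tendsto shift).isBigO
  simp only [Function.comp_def, add_sub_cancel_left] at main
  have last : (fun h : ℝ => iteratedDeriv n φ x₀ / (n.factorial : ℝ) * h ^ n)
      =O[𝓝 0] (fun h : ℝ => h ^ n) := isBigO_const_mul_self _ _ _
  refine (main.add last).congr_left fun h => ?_
  have coeff (k : ℕ) : iteratedDerivWithin k φ (Set.Ioo lo hi) x₀ = iteratedDeriv k φ x₀ :=
    iteratedDerivWithin_of_isOpen isOpen_Ioo hx
  have sum_eq : taylorWithinEval φ n (Set.Ioo lo hi) x₀ (x₀ + h) =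
      ∑ k ∈ Finset.range (n + 1), iteratedDeriv k φ x₀ / (k.factorial : ℝ) * h ^ k := by
    rw [taylor_within_apply]
    refine Finset.sum_congr rfl fun k _ => ?_
    rw [coeff, add_sub_cancel_left, smul_eq_mul]
    ring
  rw [sum_eq, Finset.sum_range_succ]
  ring

/-- An `O(hⁿ)` estimate at `0` is invariant under `h ↦ -h`. -/
theorem Asymptotics.IsBigO.comp_neg_pow {r : ℝ → ℝ} {n : ℕ}
    (hr : r =O[𝓝 0] (fun h : ℝ => h ^ n)) :
    (fun h => r (-h)) =O[𝓝 0] (fun h : ℝ => h ^ n) := by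
  have neg_tendsto : Tendsto (fun h : ℝ => -h) (𝓝 0) (𝓝 0) := by
    simpa using (continuous_neg (G := ℝ)).tendsto 0
  refine (hr.comp_tendsto neg_tendsto).trans (IsBigO.of_norm_left ?_)
  simpa [Function.comp_def] using (isBigO_refl (fun h : ℝ => h ^ n) (𝓝 0)).norm_left

/-- Multiplying by a function continuous at the base point preserves big-O estimates. -/
theorem ContinuousAt.mul_isBigO {c r s : ℝ → ℝ} {a : ℝ} (hc : ContinuousAt c a)
    (hr : r =O[𝓝 a] s) : (fun h => c h * r h) =O[𝓝 a] s := by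
  simpa using (hc.tendsto.isBigO_one ℝ).mul hr

section ThreePointFormulas

variable {x₀ lo hi : ℝ} {y : ℝ → ℝ}

/-- The remainders of the Taylor expansions of `y`, `y'` and `y''` of degrees `7`, `5` and `5`. -/
theorem taylor_remainders (hx : x₀ ∈ Set.Ioo lo hi) (hy : ContDiffOn ℝ 8 y (Set.Ioo lo hi)) :
    ∃ r r' r'' : ℝ → ℝ,
      r =O[𝓝 0] (fun h : ℝ => h ^ 8) ∧ r' =O[𝓝 0] (fun h : ℝ => h ^ 6) ∧
      r'' =O[𝓝 0] (fun h : ℝ => h ^ 6) ∧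
      (∀ h, y (x₀ + h) = y x₀ + h * deriv y x₀ + h ^ 2 / 2 * deriv (deriv y) x₀
        + h ^ 3 / 6 * iteratedDeriv 3 y x₀ + h ^ 4 / 24 * iteratedDeriv 4 y x₀
        + h ^ 5 / 120 * iteratedDeriv 5 y x₀ + h ^ 6 / 720 * iteratedDeriv 6 y x₀
        + h ^ 7 / 5040 * iteratedDeriv 7 y x₀ + r h) ∧
      (∀ h, deriv y (x₀ + h) = deriv y x₀ + h * deriv (deriv y) x₀
        + h ^ 2 / 2 * iteratedDeriv 3 y x₀ + h ^ 3 / 6 * iteratedDeriv 4 y x₀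
        + h ^ 4 / 24 * iteratedDeriv 5 y x₀ + h ^ 5 / 120 * iteratedDeriv 6 y x₀ + r' h) ∧
      (∀ h, deriv (deriv y) (x₀ + h) = deriv (deriv y) x₀ + h * iteratedDeriv 3 y x₀
        + h ^ 2 / 2 * iteratedDeriv 4 y x₀ + h ^ 3 / 6 * iteratedDeriv 5 y x₀
        + h ^ 4 / 24 * iteratedDeriv 6 y x₀ + h ^ 5 / 120 * iteratedDeriv 7 y x₀ + r'' h) := by
  have hy' : ContDiffOn ℝ 7 (deriv y) (Set.Ioo lo hi) :=
    hy.deriv_of_isOpen isOpen_Ioo (by norm_num)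
  have hy'' : ContDiffOn ℝ 6 (deriv (deriv y)) (Set.Ioo lo hi) :=
    hy'.deriv_of_isOpen isOpen_Ioo (by norm_num)
  have iter_two : iteratedDeriv 2 y = deriv (deriv y) := by
    rw [iteratedDeriv_succ, iteratedDeriv_one]
  refine ⟨_, _, _, ContDiffOn.sub_taylor_isBigO (n := 8) hx hy,
    ContDiffOn.sub_taylor_isBigO (n := 6) hx (hy'.of_le (by norm_num)),
    ContDiffOn.sub_taylor_isBigO (n := 6) hx hy'', fun h => ?_, fun h => ?_, fun h => ?_⟩
  all_goals
    simp only [Finset.sum_range_succ, Finset.sum_range_zero, ← iteratedDeriv_succ', iter_two,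
      iteratedDeriv_zero, zero_add, iteratedDeriv_one, Nat.factorial]
    push_cast
    ring

/-- Numerov's three-point formula. -/
theorem numerov_isBigO (hx : x₀ ∈ Set.Ioo lo hi) (hy : ContDiffOn ℝ 8 y (Set.Ioo lo hi)) :
    (fun h : ℝ => y (x₀ + h) - 2 * y x₀ + y (x₀ - h)
      - h ^ 2 / 12 * (deriv (deriv y) (x₀ + h) + 10 * deriv (deriv y) x₀
        + deriv (deriv y) (x₀ - h)) + h ^ 6 / 240 * iteratedDeriv 6 y x₀)
      =O[𝓝 0] (fun h : ℝ => h ^ 8) := by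
  obtain ⟨r, -, r'', hr, -, hr'', ey, -, ey''⟩ := taylor_remainders hx hy
  have sq_mul : (fun h => h ^ 2 * (r'' h + r'' (-h))) =O[𝓝 0] (fun h : ℝ => h ^ 8) :=
    ((isBigO_refl (fun h : ℝ => h ^ 2) _).mul (hr''.add hr''.comp_neg_pow)).congr_right
      fun h => by ring
  refine ((hr.add hr.comp_neg_pow).sub (sq_mul.const_mul_left (1 / 12))).congr_left fun h => ?_
  simp only [sub_eq_add_neg, ey, ey'']
  ring

/-- The three-point formula for `h y'(x₀)`, with its leading error term. -/
theorem central_deriv_isBigO (hx : x₀ ∈ Set.Ioo lo hi)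
    (hy : ContDiffOn ℝ 8 y (Set.Ioo lo hi)) :
    (fun h : ℝ => h * deriv y x₀ - (y (x₀ + h) - y (x₀ - h)) / 2
      + h ^ 2 / 12 * (deriv (deriv y) (x₀ + h) - deriv (deriv y) (x₀ - h))
      - 7 / 360 * h ^ 5 * iteratedDeriv 5 y x₀)
      =O[𝓝 0] (fun h : ℝ => h ^ 7) := by
  obtain ⟨r, -, r'', hr, -, hr'', ey, -, ey''⟩ := taylor_remainders hx hy
  have pow_le : (fun h : ℝ => h ^ 8) =O[𝓝 0] (fun h : ℝ => h ^ 7) :=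
    (isLittleO_pow_pow (by norm_num)).isBigO
  have sq_mul : (fun h => h ^ 2 * (r'' h - r'' (-h))) =O[𝓝 0] (fun h : ℝ => h ^ 8) :=
    ((isBigO_refl (fun h : ℝ => h ^ 2) _).mul (hr''.sub hr''.comp_neg_pow)).congr_right
      fun h => by ring
  have tail : (fun h : ℝ => (1 / 720 - 1 / 5040) * iteratedDeriv 7 y x₀ * h ^ 7)
      =O[𝓝 0] (fun h : ℝ => h ^ 7) := isBigO_const_mul_self _ _ _
  refine (((((hr.sub hr.comp_neg_pow).const_mul_left (-1 / 2)).add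
    (sq_mul.const_mul_left (1 / 12))).trans pow_le).add tail).congr_left fun h => ?_
  simp only [sub_eq_add_neg, ey, ey'']
  ring

/-- The three-point formula for `h y'(x₀ + h)`, with its leading error terms. -/
theorem forward_deriv_isBigO (hx : x₀ ∈ Set.Ioo lo hi)
    (hy : ContDiffOn ℝ 8 y (Set.Ioo lo hi)) :
    (fun h : ℝ => h * deriv y (x₀ + h) - (y (x₀ + h) - y (x₀ - h)) / 2
      - h ^ 2 / 3 * (deriv (deriv y) (x₀ + h) + 2 * deriv (deriv y) x₀)
      + h ^ 5 / 45 * iteratedDeriv 5 y x₀ + h ^ 6 / 180 * iteratedDeriv 6 y x₀)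
      =O[𝓝 0] (fun h : ℝ => h ^ 7) := by
  obtain ⟨r, r', r'', hr, hr', hr'', ey, ey', ey''⟩ := taylor_remainders hx hy
  have pow_le : (fun h : ℝ => h ^ 8) =O[𝓝 0] (fun h : ℝ => h ^ 7) :=
    (isLittleO_pow_pow (by norm_num)).isBigO
  have id_mul : (fun h => h * r' h) =O[𝓝 0] (fun h : ℝ => h ^ 7) :=
    ((isBigO_refl (fun h : ℝ => h) _).mul hr').congr_right fun h => by ring
  have sq_mul : (fun h => h ^ 2 * r'' h) =O[𝓝 0] (fun h : ℝ => h ^ 8) :=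
    ((isBigO_refl (fun h : ℝ => h ^ 2) _).mul hr'').congr_right fun h => by ring
  have tail : (fun h : ℝ => (-1 / 5040 - 1 / 360) * iteratedDeriv 7 y x₀ * h ^ 7)
      =O[𝓝 0] (fun h : ℝ => h ^ 7) := isBigO_const_mul_self _ _ _
  refine ((((((hr.sub hr.comp_neg_pow).const_mul_left (-1 / 2)).sub
    (sq_mul.const_mul_left (1 / 3))).trans pow_le).add id_mul).add tail).congr_left fun h => ?_
  simp only [sub_eq_add_neg, ey, ey', ey'']
  ring

/-- The three-point formula for `h y'(x₀ - h)`, with its leading error terms. -/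
theorem backward_deriv_isBigO (hx : x₀ ∈ Set.Ioo lo hi)
    (hy : ContDiffOn ℝ 8 y (Set.Ioo lo hi)) :
    (fun h : ℝ => h * deriv y (x₀ - h) - (y (x₀ + h) - y (x₀ - h)) / 2
      + h ^ 2 / 3 * (deriv (deriv y) (x₀ - h) + 2 * deriv (deriv y) x₀)
      + h ^ 5 / 45 * iteratedDeriv 5 y x₀ - h ^ 6 / 180 * iteratedDeriv 6 y x₀)
      =O[𝓝 0] (fun h : ℝ => h ^ 7) := by
  refine (forward_deriv_isBigO hx hy).comp_neg_pow.neg_left.congr_left fun h => ?_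
  simp only [sub_neg_eq_add, ← sub_eq_add_neg]
  ring

end ThreePointFormulas

/-- First and second symmetric differences of a `C²` function are `O(h)` and `O(h²)`. -/
theorem ContDiffOn.symm_diff_isBigO {g : ℝ → ℝ} {x₀ lo hi : ℝ} (hx : x₀ ∈ Set.Ioo lo hi)
    (hg : ContDiffOn ℝ 2 g (Set.Ioo lo hi)) :
    (fun h : ℝ => g (x₀ + h) - g (x₀ - h)) =O[𝓝 0] (fun h : ℝ => h) ∧
    (fun h : ℝ => g (x₀ + h) + g (x₀ - h) - 2 * g x₀) =O[𝓝 0] (fun h : ℝ => h ^ 2) := by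
  have first := ContDiffOn.sub_taylor_isBigO (n := 1) hx (hg.of_le (by norm_num))
  have second := ContDiffOn.sub_taylor_isBigO (n := 2) hx hg
  constructor
  · refine (first.sub first.comp_neg_pow).congr (fun h => ?_) fun h => pow_one h
    simp [sub_eq_add_neg]
  · refine (second.add second.comp_neg_pow).congr_left fun h => ?_
    simp only [Finset.sum_range_succ, Finset.sum_range_zero, iteratedDeriv_zero, sub_eq_add_neg,
      Nat.factorial]
    push_cast
    ring

/-- Generalized linear Numerov formula with sixth-order local truncation error:
`T₀·y₀ − T₊·y₊ − T₋·y₋ − (h⁶/240)·(y⁽⁶⁾₀ + 3·g₀·y⁽⁵⁾₀) = O(h⁸)` as `h → 0`. -/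
theorem generalized_numerov_formula
    (x₀ lo hi : ℝ) (y g f : ℝ → ℝ)
    (hx : x₀ ∈ Set.Ioo lo hi)
    (hy : ContDiffOn ℝ 8 y (Set.Ioo lo hi))
    (hg : ContDiffOn ℝ 8 g (Set.Ioo lo hi))
    (hf : ContDiffOn ℝ 8 f (Set.Ioo lo hi))
    (hode : ∀ x ∈ Set.Ioo lo hi,
      deriv (deriv y) x + g x * deriv y x + f x * y x = 0) :
    (fun h : ℝ =>
      let g0 := g x₀
      let gp := g (x₀ + h)
      let gm := g (x₀ - h)
      let a := (1 + (h / 3) * gp) * (1 - (h / 3) * gm) + (h ^ 2 / 18) * g0 * (gp + gm)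
      let b0 := (1 + (4 * h / 15) * gp) * (1 - (4 * h / 15) * gm) + (h / 15) ^ 2 * gp * gm
      let bp := (1 + (5 * h / 6) * g0) * (1 - (h / 3) * gm) + (h / 3) ^ 2 * g0 * gm
      let bm := (1 - (5 * h / 6) * g0) * (1 + (h / 3) * gp) + (h / 3) ^ 2 * g0 * gp
      let c := (1 + (7 * h / 20) * gp) * (1 - (7 * h / 20) * gm) + (3 * h / 20) ^ 2 * gp * gm
      let T0 := 2 * a - (5 * h ^ 2 / 6) * b0 * f x₀
      let Tp := a + (h / 24) * (10 * c * g0 + gp + gm) + (h ^ 2 / 12) * bp * f (x₀ + h)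
      let Tm := a - (h / 24) * (10 * c * g0 + gp + gm) + (h ^ 2 / 12) * bm * f (x₀ - h)
      T0 * y x₀ - Tp * y (x₀ + h) - Tm * y (x₀ - h)
        - (h ^ 6 / 240) * (iteratedDeriv 6 y x₀ + 3 * g0 * iteratedDeriv 5 y x₀))
      =O[𝓝 0] (fun h : ℝ => h ^ 8) := by
  have mem_nhds := isOpen_Ioo.mem_nhds hx
  have plus_tendsto : Tendsto (fun h : ℝ => x₀ + h) (𝓝 0) (𝓝 x₀) := by
    simpa using (continuous_const_add x₀).tendsto 0
  have minus_tendsto : Tendsto (fun h : ℝ => x₀ - h) (𝓝 0) (𝓝 x₀) := by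
    simpa using (continuous_sub_left x₀).tendsto 0
  have g_cont : ContinuousAt g x₀ := hg.continuousOn.continuousAt mem_nhds
  have g_cont_add : ContinuousAt g (x₀ + 0) := by simpa using g_cont
  have g_cont_sub : ContinuousAt g (x₀ - 0) := by simpa using g_cont
  obtain ⟨diff_one, diff_two⟩ := ContDiffOn.symm_diff_isBigO hx (hg.of_le (by norm_num))
  have id_mul {r : ℝ → ℝ} (hr : r =O[𝓝 0] (fun h : ℝ => h ^ 7)) :
      (fun h => h * r h) =O[𝓝 0] (fun h : ℝ => h ^ 8) :=
    ((isBigO_refl (fun h : ℝ => h) _).mul hr).congr_right fun h => by ring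
  have err_d : (fun h => h ^ 7 * (g (x₀ + h) - g (x₀ - h))) =O[𝓝 0] (fun h : ℝ => h ^ 8) :=
    ((isBigO_refl (fun h : ℝ => h ^ 7) _).mul diff_one).congr_right fun h => by ring
  have err_e : (fun h => h ^ 6 * (g (x₀ + h) + g (x₀ - h) - 2 * g x₀))
      =O[𝓝 0] (fun h : ℝ => h ^ 8) :=
    ((isBigO_refl (fun h : ℝ => h ^ 6) _).mul diff_two).congr_right fun h => by ring
  have err_h : (fun h : ℝ => h ^ 8) =O[𝓝 0] (fun h : ℝ => h ^ 8) := isBigO_refl _ _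
  -- the weights that eliminate `y'(x₀)`, `y'(x₀ + h)` and `y'(x₀ - h)`
  let P : ℝ → ℝ := fun h => 1 + h / 3 * g (x₀ + h)
  let M : ℝ → ℝ := fun h => 1 - h / 3 * g (x₀ - h)
  let A : ℝ → ℝ := fun h => P h * M h + h ^ 2 / 18 * g x₀ * (g (x₀ + h) + g (x₀ - h))
  let D : ℝ → ℝ := fun h => g x₀ * (5 / 6 * (P h * M h)
    - h / 18 * (g (x₀ + h) - g (x₀ - h)) + h ^ 2 / 27 * g (x₀ + h) * g (x₀ - h))
  let U : ℝ → ℝ := fun h => g (x₀ + h) / 12 *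
    ((1 + 5 * h / 6 * g x₀) * M h + (h / 3) ^ 2 * g x₀ * g (x₀ - h))
  let V : ℝ → ℝ := fun h => g (x₀ - h) / 12 *
    ((1 - 5 * h / 6 * g x₀) * P h + (h / 3) ^ 2 * g x₀ * g (x₀ + h))
  let Y5 := iteratedDeriv 5 y x₀
  let Y6 := iteratedDeriv 6 y x₀
  have A_cont : ContinuousAt (fun h => -A h) 0 := by fun_prop (disch := norm_num)
  have D_cont : ContinuousAt D 0 := by fun_prop (disch := norm_num)
  have U_cont : ContinuousAt U 0 := by fun_prop (disch := norm_num)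
  have V_cont : ContinuousAt V 0 := by fun_prop (disch := norm_num)
  have d_cont : ContinuousAt (fun _ : ℝ => Y6 / 1080 + Y5 * g x₀ / 360) 0 := continuousAt_const
  have e_cont : ContinuousAt (fun _ : ℝ => -Y5 / 540) 0 := continuousAt_const
  have h_cont : ContinuousAt (fun h => Y6 / 240 * (-(g (x₀ + h) * g (x₀ - h)) / 9
        + g x₀ * (g (x₀ + h) + g (x₀ - h)) / 18)
      - Y5 * (g x₀ * (g (x₀ + h) * g (x₀ - h)) / 2160)
      - Y6 / 2160 * (5 / 6 * g x₀ * (g (x₀ + h) + g (x₀ - h))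
        - 2 / 3 * (g (x₀ + h) * g (x₀ - h)))) 0 := by fun_prop (disch := norm_num)
  refine (((((((A_cont.mul_isBigO (numerov_isBigO hx hy)).add
    (D_cont.mul_isBigO (id_mul (central_deriv_isBigO hx hy)))).add
    (U_cont.mul_isBigO (id_mul (forward_deriv_isBigO hx hy)))).add
    (V_cont.mul_isBigO (id_mul (backward_deriv_isBigO hx hy)))).add
    (d_cont.mul_isBigO err_d)).add (e_cont.mul_isBigO err_e)).add
    (h_cont.mul_isBigO err_h)).congr' ?_ EventuallyEq.rfl
  filter_upwards [plus_tendsto mem_nhds, minus_tendsto mem_nhds] with h plus_mem minus_mem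
  have ode_zero := eq_neg_of_add_eq_zero_left ((add_assoc _ _ _).symm.trans (hode x₀ hx))
  have ode_plus := eq_neg_of_add_eq_zero_left ((add_assoc _ _ _).symm.trans (hode _ plus_mem))
  have ode_minus := eq_neg_of_add_eq_zero_left ((add_assoc _ _ _).symm.trans (hode _ minus_mem))
  simp only [A, D, U, V, P, M, Y5, Y6, ode_zero, ode_plus, ode_minus]
  ring
end

section
/- First-derivative formula of fourth order: as h → 0 through nonzero values, the quantity y'₀ − (S₊(h)·y₊ − S₋(h)·y₋ − S₀(h)·y₀)/(2·a(h)·h) − (7h⁴/360)·y⁽⁵⁾₀, viewed as a function of h, is O(h⁶) (equivalently, along the punctured neighborhood 𝓝[≠] 0; note a(h) → 1 as h → 0, so a(h) ≠ 0 for small h). -/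
open Asymptotics Filter Topology

/-- Taylor's theorem at an interior point of an interval, with a big-O remainder. -/
theorem taylor_isBigO_of_contDiffOn_Ioo {F : ℝ → ℝ} {x₀ lo hi : ℝ} (n : ℕ)
    (hx : x₀ ∈ Set.Ioo lo hi) (hF : ContDiffOn ℝ n F (Set.Ioo lo hi)) :
    (fun h : ℝ => F (x₀ + h)
        - ∑ k ∈ Finset.range n, iteratedDeriv k F x₀ / (k.factorial : ℝ) * h ^ k)
      =O[𝓝 0] (fun h : ℝ => h ^ n) := by
  have hTaylor := (taylor_isLittleO (convex_Ioo lo hi) hx hF).isBigO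
  rw [isOpen_Ioo.nhdsWithin_eq hx] at hTaylor
  have hshift : Tendsto (fun h : ℝ => x₀ + h) (𝓝 0) (𝓝 x₀) := by
    simpa using (tendsto_id (x := 𝓝 (0 : ℝ))).const_add x₀
  have hlast : (fun h : ℝ => iteratedDeriv n F x₀ / (n.factorial : ℝ) * h ^ n)
      =O[𝓝 0] (fun h : ℝ => h ^ n) := (isBigO_refl _ _).const_mul_left _
  refine ((hTaylor.comp_tendsto hshift).add (hlast.congr_right fun h => ?_)).congr ?_ ?_
  · simp
  · intro h
    have hderiv : ∀ k, iteratedDerivWithin k F (Set.Ioo lo hi) x₀ = iteratedDeriv k F x₀ :=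
      fun k => iteratedDerivWithin_of_isOpen isOpen_Ioo hx
    have hsum : ∀ k, ((k.factorial : ℝ)⁻¹ * h ^ k) * iteratedDeriv k F x₀
        = iteratedDeriv k F x₀ / (k.factorial : ℝ) * h ^ k := fun k => by ring
    simp only [Function.comp_apply, taylor_within_apply, hderiv, add_sub_cancel_left, smul_eq_mul,
      hsum, Finset.sum_range_succ]
    ring
  · intro h
    simp

/-- Replacing `h` by `-h` preserves domination by a power of `h` near `0`. -/
theorem isBigO_pow_comp_neg {F : ℝ → ℝ} {n : ℕ} (hF : F =O[𝓝 0] (fun h : ℝ => h ^ n)) :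
    (fun h : ℝ => F (-h)) =O[𝓝 0] (fun h : ℝ => h ^ n) := by
  have hneg : Tendsto (fun h : ℝ => -h) (𝓝 0) (𝓝 0) := by
    simpa using (continuous_neg : Continuous fun h : ℝ => -h).tendsto 0
  refine (hF.comp_tendsto hneg).trans (isBigO_of_le _ fun h => ?_)
  simp

section Quadrature

variable {y : ℝ → ℝ} {x₀ lo hi : ℝ}

/-- Simpson's rule for `y'` on `[x₀ - h, x₀ + h]`, with its error term. -/
theorem simpson_isBigO (hx : x₀ ∈ Set.Ioo lo hi) (hy : ContDiffOn ℝ 5 y (Set.Ioo lo hi)) :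
    (fun h : ℝ => h * (deriv y (x₀ + h) + deriv y (x₀ - h)) - 3 * (y (x₀ + h) - y (x₀ - h))
        + 4 * h * deriv y x₀) =O[𝓝 0] (fun h : ℝ => h ^ 5) := by
  have hy₁ : ContDiffOn ℝ 4 (deriv y) (Set.Ioo lo hi) :=
    hy.deriv_of_isOpen isOpen_Ioo (by norm_num)
  have T := taylor_isBigO_of_contDiffOn_Ioo 5 hx hy
  have T₁ := taylor_isBigO_of_contDiffOn_Ioo 4 hx hy₁
  have hid := isBigO_refl (fun h : ℝ => h) (𝓝 0)
  refine (((hid.mul (T₁.add (isBigO_pow_comp_neg T₁))).congr_right fun h => ?_).sub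
    ((T.sub (isBigO_pow_comp_neg T)).const_mul_left 3)).congr_left fun h => ?_
  · ring
  · simp only [← iteratedDeriv_succ', Finset.sum_range_succ, Finset.sum_range_zero,
      Nat.factorial, ← sub_eq_add_neg, zero_add, iteratedDeriv_one]
    push_cast
    ring

/-- A symmetric difference formula for `y'` using `y` and `y''` at `x₀ ± h`. -/
theorem deriv_sub_symmetric_difference_isBigO (hx : x₀ ∈ Set.Ioo lo hi)
    (hy : ContDiffOn ℝ 7 y (Set.Ioo lo hi)) :
    (fun h : ℝ => 2 * h * deriv y x₀ - (y (x₀ + h) - y (x₀ - h))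
        + h ^ 2 / 6 * (deriv (deriv y) (x₀ + h) - deriv (deriv y) (x₀ - h))
        - 7 / 180 * h ^ 5 * iteratedDeriv 5 y x₀) =O[𝓝 0] (fun h : ℝ => h ^ 7) := by
  have hy₁ : ContDiffOn ℝ 6 (deriv y) (Set.Ioo lo hi) :=
    hy.deriv_of_isOpen isOpen_Ioo (by norm_num)
  have hy₂ : ContDiffOn ℝ 5 (deriv (deriv y)) (Set.Ioo lo hi) :=
    hy₁.deriv_of_isOpen isOpen_Ioo (by norm_num)
  have T := taylor_isBigO_of_contDiffOn_Ioo 7 hx hy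
  have T₂ := taylor_isBigO_of_contDiffOn_Ioo 5 hx hy₂
  have hsq := (isBigO_refl (fun h : ℝ => h ^ 2) (𝓝 0)).const_mul_left (1 / 6)
  refine (((hsq.mul (T₂.sub (isBigO_pow_comp_neg T₂))).congr_right fun h => ?_).sub
    (T.sub (isBigO_pow_comp_neg T))).congr_left fun h => ?_
  · ring
  · simp only [← iteratedDeriv_succ', Finset.sum_range_succ, Finset.sum_range_zero,
      Nat.factorial, ← sub_eq_add_neg, zero_add, iteratedDeriv_one]
    push_cast
    ring

end Quadrature

/-- First-derivative formula of fourth order: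
`y'₀ − (S₊·y₊ − S₋·y₋ − S₀·y₀)/(2ah) − (7h⁴/360)·y⁽⁵⁾₀ = O(h⁶)` as `h → 0`
through nonzero values. -/
theorem first_derivative_fourth_order_formula
    (x₀ lo hi : ℝ) (y g f : ℝ → ℝ)
    (hx : x₀ ∈ Set.Ioo lo hi)
    (hy : ContDiffOn ℝ 8 y (Set.Ioo lo hi))
    (hg : ContDiffOn ℝ 8 g (Set.Ioo lo hi))
    (hf : ContDiffOn ℝ 8 f (Set.Ioo lo hi))
    (hode : ∀ x ∈ Set.Ioo lo hi,
      deriv (deriv y) x + g x * deriv y x + f x * y x = 0) :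
    (fun h : ℝ =>
      let gp := g (x₀ + h)
      let gm := g (x₀ - h)
      let a := (1 + (h / 3) * gp) * (1 - (h / 3) * gm) + (h ^ 2 / 18) * g x₀ * (gp + gm)
      let S0 := (h ^ 3 / 9) * (gp + gm) * f x₀
      let Sp := (1 + (5 * h / 12) * gp) * (1 - (5 * h / 12) * gm) + (h / 12) ^ 2 * gp * gm
        + (h ^ 2 / 6) * (1 - (h / 3) * gm) * f (x₀ + h)
      let Sm := (1 + (5 * h / 12) * gp) * (1 - (5 * h / 12) * gm) + (h / 12) ^ 2 * gp * gm
        + (h ^ 2 / 6) * (1 + (h / 3) * gp) * f (x₀ - h)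
      deriv y x₀ - (Sp * y (x₀ + h) - Sm * y (x₀ - h) - S0 * y x₀) / (2 * a * h)
        - (7 * h ^ 4 / 360) * iteratedDeriv 5 y x₀)
      =O[𝓝[≠] 0] (fun h : ℝ => h ^ 6) := by
  have hy₁ : ContDiffOn ℝ 7 (deriv y) (Set.Ioo lo hi) :=
    hy.deriv_of_isOpen isOpen_Ioo (by norm_num)
  have hgc : ContinuousAt g x₀ := hg.continuousOn.continuousAt (isOpen_Ioo.mem_nhds hx)
  have hplus : Tendsto (fun h : ℝ => x₀ + h) (𝓝 0) (𝓝 x₀) := by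
    simpa using (tendsto_id (x := 𝓝 (0 : ℝ))).const_add x₀
  have hminus : Tendsto (fun h : ℝ => x₀ - h) (𝓝 0) (𝓝 x₀) := by
    simpa using (tendsto_id (x := 𝓝 (0 : ℝ))).const_sub x₀
  have hgp : Tendsto (fun h : ℝ => g (x₀ + h)) (𝓝 0) (𝓝 (g x₀)) := hgc.tendsto.comp hplus
  have hgm : Tendsto (fun h : ℝ => g (x₀ - h)) (𝓝 0) (𝓝 (g x₀)) := hgc.tendsto.comp hminus
  have hid : Tendsto (fun h : ℝ => h) (𝓝 0) (𝓝 0) := tendsto_id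
  -- the three quadrature errors
  have E₁ := simpson_isBigO hx (hy.of_le (by norm_num))
  have E₂ := simpson_isBigO hx (hy₁.of_le (by norm_num))
  have E₃ := deriv_sub_symmetric_difference_isBigO hx (hy.of_le (by norm_num))
  -- the coefficients with which they enter
  have hdiff : (fun h : ℝ => g (x₀ + h) - g (x₀ - h)) =O[𝓝 0] (fun h : ℝ => h) := by
    have T := taylor_isBigO_of_contDiffOn_Ioo 1 hx (hg.of_le (by norm_num))
    refine (T.sub (isBigO_pow_comp_neg T)).congr (fun h => ?_) fun h => pow_one h
    simp [← sub_eq_add_neg]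
  have hhdiff : (fun h : ℝ => h * (g (x₀ + h) - g (x₀ - h))) =O[𝓝 0] (fun h : ℝ => h ^ 2) :=
    ((isBigO_refl (fun h : ℝ => h) (𝓝 0)).mul hdiff).congr_right fun h => (sq h).symm
  have hsq {c : ℝ → ℝ} {l : ℝ} (hc : Tendsto c (𝓝 0) (𝓝 l)) :
      (fun h : ℝ => h ^ 2 * c h) =O[𝓝 0] (fun h : ℝ => h ^ 2) :=
    ((isBigO_refl (fun h : ℝ => h ^ 2) (𝓝 0)).mul (hc.isBigO_one ℝ)).congr_right
      fun h => mul_one _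
  have C₁ := (hhdiff.const_mul_left (1 / 6)).sub
    ((hsq (hgp.mul hgm)).const_mul_left (1 / 9))
  have C₂ := (hsq (hgp.add hgm)).const_mul_left (1 / 6)
  have C₃ : (fun h : ℝ => 2 + h / 3 * (g (x₀ + h) - g (x₀ - h))) =O[𝓝 0]
      (fun _ : ℝ => (1 : ℝ)) :=
    ((hid.div_const 3).mul (hgp.sub hgm) |>.const_add 2).isBigO_one ℝ
  have C₄ := ((hhdiff.const_mul_left (-1 / 3)).add
    ((hsq (hgp.mul hgm)).const_mul_left (2 / 9))).sub
      ((hsq ((hgp.add hgm).const_mul (g x₀))).const_mul_left (1 / 9))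
  have H₂ : (fun h : ℝ => deriv y (x₀ + h) - deriv y (x₀ - h)
      - h / 3 * (deriv (deriv y) (x₀ + h) + 4 * deriv (deriv y) x₀ + deriv (deriv y) (x₀ - h)))
      =O[𝓝 0] (fun h : ℝ => h ^ 5) :=
    (E₂.const_mul_left (-1 / 3)).congr_left fun h => by ring
  have hH : (fun h : ℝ => h ^ 5 * (7 / 180 * iteratedDeriv 5 y x₀)) =O[𝓝 0]
      (fun h : ℝ => h ^ 5) :=
    ((isBigO_refl (fun h : ℝ => h ^ 5) (𝓝 0)).const_mul_left
      (7 / 180 * iteratedDeriv 5 y x₀)).congr_left fun h => by ring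
  have hpow (h : ℝ) : h ^ 2 * h ^ 5 = h ^ 7 := by ring
  have hnum := ((((C₃.mul E₃).congr_right fun h => one_mul _).add
    ((C₁.mul E₁).congr_right hpow)).add ((C₂.mul H₂).congr_right hpow)).add
      ((C₄.mul hH).congr_right hpow)
  have ha : Tendsto (fun h : ℝ => (1 + (h / 3) * g (x₀ + h)) * (1 - (h / 3) * g (x₀ - h))
      + (h ^ 2 / 18) * g x₀ * (g (x₀ + h) + g (x₀ - h))) (𝓝 0) (𝓝 1) := by
    have := ((((hid.div_const 3).mul hgp).const_add 1).mul
      (((hid.div_const 3).mul hgm).const_sub 1)).add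
      ((((hid.pow 2).div_const 18).mul_const (g x₀)).mul (hgp.add hgm))
    simpa using this
  have hinv := ((ha.const_mul 4).inv₀ (by norm_num)).isBigO_one ℝ
  have hquot := ((hnum.mul hinv).mono nhdsWithin_le_nhds).mul
    (isBigO_refl (fun h : ℝ => h⁻¹) (𝓝[≠] 0))
  refine hquot.congr' ?_ ?_
  · have hI := isOpen_Ioo.mem_nhds hx
    filter_upwards [self_mem_nhdsWithin, nhdsWithin_le_nhds (hplus hI),
      nhdsWithin_le_nhds (hminus hI), nhdsWithin_le_nhds (ha.eventually_ne one_ne_zero)]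
      with h hh hp hm hane
    have hh : h ≠ 0 := hh
    have ode_plus : deriv (deriv y) (x₀ + h) + g (x₀ + h) * deriv y (x₀ + h)
        + f (x₀ + h) * y (x₀ + h) = 0 := hode _ hp
    have ode_minus : deriv (deriv y) (x₀ - h) + g (x₀ - h) * deriv y (x₀ - h)
        + f (x₀ - h) * y (x₀ - h) = 0 := hode _ hm
    have ode_zero := hode _ hx
    set a := (1 + (h / 3) * g (x₀ + h)) * (1 - (h / 3) * g (x₀ - h))
      + (h ^ 2 / 18) * g x₀ * (g (x₀ + h) + g (x₀ - h)) with ha_def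
    dsimp only
    rw [← ha_def, ← div_eq_mul_inv, ← div_eq_mul_inv, div_div, div_eq_iff (by positivity)]
    have hcancel (Z N W : ℝ) : (Z - N / (2 * a * h) - W) * (4 * a * h)
        = 4 * a * h * (Z - W) - 2 * N := by
      field_simp
      ring
    rw [hcancel, ha_def]
    linear_combination
      ((2 + h / 3 * (g (x₀ + h) - g (x₀ - h))) * h ^ 2 / 6
        - h ^ 3 / 18 * (g (x₀ + h) + g (x₀ - h))) * ode_plus
      + (-(2 + h / 3 * (g (x₀ + h) - g (x₀ - h))) * h ^ 2 / 6
        - h ^ 3 / 18 * (g (x₀ + h) + g (x₀ - h))) * ode_minus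
      - 2 / 9 * h ^ 3 * (g (x₀ + h) + g (x₀ - h)) * ode_zero
  · filter_upwards [self_mem_nhdsWithin] with h hh
    have hh : h ≠ 0 := hh
    field_simp
end

section
/- Endpoint derivative formula: as h → 0 the quantity (3 + h·g₊)·y'₊ − (3 − h·g₋)·y'₋ + h·(4·g₀·y'₀ + 4·f₀·y₀ + f₊·y₊ + f₋·y₋) + (h⁵/30)·y⁽⁶⁾₀, viewed as a function of h, is O(h⁷). Consequently, for h in a punctured neighborhood of 0 one has 3 + h·g₊ ≠ 0 and y'₊ − [(3 − h·g₋)·y'₋ − h·(4·g₀·y'₀ + 4·f₀·y₀ + f₊·y₊ + f₋·y₋)]/(3 + h·g₊) + (h⁵/90)·y⁽⁶⁾₀ is O(h⁶). -/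
open Asymptotics Filter Topology

/-- Taylor's theorem with Peano remainder at a point of an open interval, in increment form. -/
theorem isLittleO_sub_sum_iteratedDeriv {u : ℝ → ℝ} {x₀ lo hi : ℝ} {n : ℕ}
    (hx : x₀ ∈ Set.Ioo lo hi) (hu : ContDiffOn ℝ n u (Set.Ioo lo hi)) :
    (fun h : ℝ => u (x₀ + h) -
        ∑ k ∈ Finset.range (n + 1), iteratedDeriv k u x₀ * h ^ k / (k.factorial : ℝ))
      =o[𝓝 0] fun h : ℝ => h ^ n := by
  have hT := taylor_isLittleO (convex_Ioo lo hi) hx hu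
  rw [isOpen_Ioo.nhdsWithin_eq hx] at hT
  have hlim : Tendsto (fun h : ℝ => x₀ + h) (𝓝 0) (𝓝 x₀) := by
    simpa using (continuous_const_add x₀).tendsto 0
  refine (hT.comp_tendsto hlim).congr (fun h => ?_) (fun h => by simp)
  simp only [Function.comp_apply, taylor_within_apply, add_sub_cancel_left, smul_eq_mul]
  congr 1
  refine Finset.sum_congr rfl fun k _ => ?_
  rw [iteratedDerivWithin_of_isOpen isOpen_Ioo hx]
  ring

/-- Simpson's rule applied to the derivative of a `C⁷` function, with its leading error term. -/
theorem simpson_deriv_isBigO {u : ℝ → ℝ} {x₀ lo hi : ℝ}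
    (hx : x₀ ∈ Set.Ioo lo hi) (hu : ContDiffOn ℝ 7 u (Set.Ioo lo hi)) :
    (fun h : ℝ => 3 * (u (x₀ + h) - u (x₀ - h))
        - h * (deriv u (x₀ + h) + 4 * deriv u x₀ + deriv u (x₀ - h))
        + h ^ 5 / 30 * iteratedDeriv 5 u x₀)
      =O[𝓝 0] fun h : ℝ => h ^ 7 := by
  have hneg : Tendsto (fun h : ℝ => -h) (𝓝 0) (𝓝 0) := by
    simpa using (continuous_neg (G := ℝ)).tendsto 0
  have hu' : ContDiffOn ℝ 6 (deriv u) (Set.Ioo lo hi) :=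
    hu.deriv_of_isOpen isOpen_Ioo (by norm_num)
  have hA := (isLittleO_sub_sum_iteratedDeriv (n := 7) hx hu).isBigO
  have hB := (isLittleO_sub_sum_iteratedDeriv (n := 6) hx hu').isBigO
  have hA' := (hA.comp_tendsto hneg).trans
    (IsBigO.of_bound' (g := fun h : ℝ => h ^ 7) (.of_forall fun h => by simp))
  have hB' := (hB.comp_tendsto hneg).trans
    (IsBigO.of_bound' (g := fun h : ℝ => h ^ 6) (.of_forall fun h => by simp))
  have hC := (isBigO_refl (fun h : ℝ => h) (𝓝 0)).mul (hB.add hB')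
  have hD := (isBigO_refl (fun h : ℝ => h ^ 7) (𝓝 0)).const_mul_left (-iteratedDeriv 7 u x₀ / 630)
  refine ((((hA.sub hA').const_mul_left 3).sub
    (hC.congr_right fun h => (pow_succ' h 6).symm)).add hD).congr_left fun h => ?_
  simp only [Function.comp_apply, Finset.sum_range_succ, Finset.sum_range_zero,
    ← iteratedDeriv_succ', Nat.factorial, ← sub_eq_add_neg, zero_add, iteratedDeriv_one]
  push_cast
  ring

/-- Endpoint derivative formula: the denominator-cleared form is `O(h⁷)` as `h → 0`;
consequently `3 + h·g₊ ≠ 0` in a punctured neighborhood of `0` and the solved form for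
`y'₊` has local truncation error `O(h⁶)` along `𝓝[≠] 0`. -/
theorem endpoint_derivative_formula
    (x₀ lo hi : ℝ) (y g f : ℝ → ℝ)
    (hx : x₀ ∈ Set.Ioo lo hi)
    (hy : ContDiffOn ℝ 8 y (Set.Ioo lo hi))
    (hg : ContDiffOn ℝ 8 g (Set.Ioo lo hi))
    (hf : ContDiffOn ℝ 8 f (Set.Ioo lo hi))
    (hode : ∀ x ∈ Set.Ioo lo hi,
      deriv (deriv y) x + g x * deriv y x + f x * y x = 0) :
    ((fun h : ℝ =>
        (3 + h * g (x₀ + h)) * deriv y (x₀ + h)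
          - (3 - h * g (x₀ - h)) * deriv y (x₀ - h)
          + h * (4 * g x₀ * deriv y x₀ + 4 * f x₀ * y x₀
             + f (x₀ + h) * y (x₀ + h) + f (x₀ - h) * y (x₀ - h))
          + (h ^ 5 / 30) * iteratedDeriv 6 y x₀)
        =O[𝓝 0] (fun h : ℝ => h ^ 7))
    ∧ (∀ᶠ h : ℝ in 𝓝[≠] 0, 3 + h * g (x₀ + h) ≠ 0)
    ∧ ((fun h : ℝ =>
        deriv y (x₀ + h)
          - ((3 - h * g (x₀ - h)) * deriv y (x₀ - h)
              - h * (4 * g x₀ * deriv y x₀ + 4 * f x₀ * y x₀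
                 + f (x₀ + h) * y (x₀ + h) + f (x₀ - h) * y (x₀ - h)))
            / (3 + h * g (x₀ + h))
          + (h ^ 5 / 90) * iteratedDeriv 6 y x₀)
        =O[𝓝[≠] 0] (fun h : ℝ => h ^ 6)) := by
  have hy' : ContDiffOn ℝ 7 (deriv y) (Set.Ioo lo hi) :=
    hy.deriv_of_isOpen isOpen_Ioo (by norm_num)
  have hplus : Tendsto (fun h : ℝ => x₀ + h) (𝓝 0) (𝓝 x₀) := by
    simpa using (continuous_const_add x₀).tendsto 0
  have hminus : Tendsto (fun h : ℝ => x₀ - h) (𝓝 0) (𝓝 x₀) := by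
    simpa using (continuous_sub_left x₀).tendsto 0
  have hI : Set.Ioo lo hi ∈ 𝓝 x₀ := isOpen_Ioo.mem_nhds hx
  have hcleared : (fun h : ℝ =>
        (3 + h * g (x₀ + h)) * deriv y (x₀ + h)
          - (3 - h * g (x₀ - h)) * deriv y (x₀ - h)
          + h * (4 * g x₀ * deriv y x₀ + 4 * f x₀ * y x₀
             + f (x₀ + h) * y (x₀ + h) + f (x₀ - h) * y (x₀ - h))
          + (h ^ 5 / 30) * iteratedDeriv 6 y x₀)
        =O[𝓝 0] (fun h : ℝ => h ^ 7) := by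
    refine (simpson_deriv_isBigO hx hy').congr' ?_ .rfl
    filter_upwards [hplus hI, hminus hI] with h hp hm
    rw [iteratedDeriv_succ' (n := 5) (f := y)]
    linear_combination (-h) * hode _ hp - 4 * h * hode _ hx - h * hode _ hm
  have hgplus : Tendsto (fun h : ℝ => g (x₀ + h)) (𝓝 0) (𝓝 (g x₀)) :=
    (hg.continuousOn.continuousAt hI).tendsto.comp hplus
  have hden : Tendsto (fun h : ℝ => 3 + h * g (x₀ + h)) (𝓝 0) (𝓝 3) := by
    simpa using (tendsto_id.mul hgplus).const_add 3
  have hne : ∀ᶠ h : ℝ in 𝓝 0, 3 + h * g (x₀ + h) ≠ 0 := hden.eventually_ne (by norm_num)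
  refine ⟨hcleared, hne.filter_mono nhdsWithin_le_nhds, IsBigO.mono ?_ nhdsWithin_le_nhds⟩
  have hinv : (fun h : ℝ => (3 + h * g (x₀ + h))⁻¹) =O[𝓝 0] fun _ => (1 : ℝ) :=
    (hden.inv₀ (by norm_num)).isBigO_one ℝ
  have hcorr : (fun h : ℝ => h ^ 6 * (g (x₀ + h) * (iteratedDeriv 6 y x₀ / 90)))
      =O[𝓝 0] fun h : ℝ => h ^ 6 := by
    simpa using (isBigO_refl (fun h : ℝ => h ^ 6) (𝓝 0)).mul
      ((hgplus.mul_const (iteratedDeriv 6 y x₀ / 90)).isBigO_one ℝ)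
  have hnum := (hcleared.trans (isLittleO_pow_pow (by norm_num : 6 < 7)).isBigO).add hcorr
  refine (hnum.mul hinv).congr' ?_ (.of_forall fun h => mul_one _)
  filter_upwards [hne] with h hh
  field_simp
  ring
end

section
/- Third-derivative difference formula: as h → 0 the quantity 2h·y'''₀ − (g₋·y'₋ + f₋·y₋ − g₊·y'₊ − f₊·y₊) + (h³/3)·y⁽⁵⁾₀, viewed as a function of h, is O(h⁵). (This is the denominator-cleared form of y'''₀ = [g₋·y'₋ + f₋·y₋ − g₊·y'₊ − f₊·y₊]/(2h) − (h²/6)·y⁽⁵⁾₀ + O(h⁴).) -/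
open Asymptotics Filter Topology

/-- Central difference expansion: the odd part of a `C⁵` function around `x₀` agrees with its
cubic Taylor polynomial up to `O(h⁵)`. -/
theorem central_difference_isBigO {u : ℝ → ℝ} {s : Set ℝ} {x₀ : ℝ} (hs : IsOpen s)
    (hconv : Convex ℝ s) (hx : x₀ ∈ s) (hu : ContDiffOn ℝ 5 u s) :
    (fun h : ℝ => u (x₀ + h) - u (x₀ - h) - 2 * h * iteratedDeriv 1 u x₀
      - h ^ 3 / 3 * iteratedDeriv 3 u x₀) =O[𝓝 0] (fun h : ℝ => h ^ 5) := by
  have taylor : (fun x => u x - taylorWithinEval u 5 s x₀ x) =O[𝓝 x₀]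
      (fun x => (x - x₀) ^ 5) := by
    have := (taylor_isLittleO (n := 5) hconv hx hu).isBigO
    rwa [hs.nhdsWithin_eq hx] at this
  have tendsto_add : Tendsto (fun h : ℝ => x₀ + h) (𝓝 0) (𝓝 x₀) := by
    simpa using (by fun_prop : Continuous fun h : ℝ => x₀ + h).tendsto 0
  have tendsto_sub : Tendsto (fun h : ℝ => x₀ - h) (𝓝 0) (𝓝 x₀) := by
    simpa using (by fun_prop : Continuous fun h : ℝ => x₀ - h).tendsto 0
  have right : (fun h : ℝ => u (x₀ + h) - taylorWithinEval u 5 s x₀ (x₀ + h)) =O[𝓝 0]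
      (fun h : ℝ => h ^ 5) := by
    simpa [Function.comp_def] using taylor.comp_tendsto tendsto_add
  have left : (fun h : ℝ => u (x₀ - h) - taylorWithinEval u 5 s x₀ (x₀ - h)) =O[𝓝 0]
      (fun h : ℝ => h ^ 5) := by
    refine (taylor.comp_tendsto tendsto_sub).trans (IsBigO.of_norm_right (IsBigO.of_norm_le fun h => ?_))
    simp
  have quintic : (fun h : ℝ => iteratedDeriv 5 u x₀ / 60 * h ^ 5) =O[𝓝 0]
      (fun h : ℝ => h ^ 5) := isBigO_const_mul_self _ _ _
  refine ((right.sub left).add quintic).congr_left fun h => ?_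
  simp only [taylor_within_apply, Finset.sum_range_succ, Finset.sum_range_zero,
    iteratedDerivWithin_of_isOpen hs hx, Nat.factorial, smul_eq_mul]
  push_cast
  ring

theorem third_derivative_difference_formula
    (x₀ lo hi : ℝ) (y g f : ℝ → ℝ)
    (hx : x₀ ∈ Set.Ioo lo hi)
    (hy : ContDiffOn ℝ 8 y (Set.Ioo lo hi))
    (hg : ContDiffOn ℝ 8 g (Set.Ioo lo hi))
    (hf : ContDiffOn ℝ 8 f (Set.Ioo lo hi))
    (hode : ∀ x ∈ Set.Ioo lo hi,
      deriv (deriv y) x + g x * deriv y x + f x * y x = 0) :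
    (fun h : ℝ =>
      2 * h * iteratedDeriv 3 y x₀
        - (g (x₀ - h) * deriv y (x₀ - h) + f (x₀ - h) * y (x₀ - h)
           - g (x₀ + h) * deriv y (x₀ + h) - f (x₀ + h) * y (x₀ + h))
        + (h ^ 3 / 3) * iteratedDeriv 5 y x₀)
      =O[𝓝 0] (fun h : ℝ => h ^ 5) := by
  have hdy : ContDiffOn ℝ 6 (deriv y) (Set.Ioo lo hi) :=
    hy.deriv_of_isOpen isOpen_Ioo (by norm_num)
  have hddy : ContDiffOn ℝ 5 (deriv (deriv y)) (Set.Ioo lo hi) :=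
    hdy.deriv_of_isOpen isOpen_Ioo (by norm_num)
  have mem_add : ∀ᶠ h : ℝ in 𝓝 0, x₀ + h ∈ Set.Ioo lo hi :=
    (continuous_const.add continuous_id).continuousAt.eventually_mem
      (isOpen_Ioo.mem_nhds (by simpa using hx))
  have mem_sub : ∀ᶠ h : ℝ in 𝓝 0, x₀ - h ∈ Set.Ioo lo hi :=
    (continuous_const.sub continuous_id).continuousAt.eventually_mem
      (isOpen_Ioo.mem_nhds (by simpa using hx))
  refine (central_difference_isBigO isOpen_Ioo (convex_Ioo lo hi) hx hddy).neg_left.congr' ?_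
    EventuallyEq.rfl
  filter_upwards [mem_add, mem_sub] with h hadd hsub
  have third : iteratedDeriv 3 y x₀ = iteratedDeriv 1 (deriv (deriv y)) x₀ := by
    simp only [iteratedDeriv_succ']
  have fifth : iteratedDeriv 5 y x₀ = iteratedDeriv 3 (deriv (deriv y)) x₀ := by
    simp only [iteratedDeriv_succ']
  rw [third, fifth]
  linear_combination hode _ hsub - hode _ hadd
end

section
/- Fourth-derivative difference formula: as h → 0 the quantity h²·y⁽⁴⁾₀ − [2·(g₀·y'₀ + f₀·y₀) − g₊·y'₊ − f₊·y₊ − g₋·y'₋ − f₋·y₋] + (h⁴/12)·y⁽⁶⁾₀, viewed as a function of h, is O(h⁶). -/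
open Asymptotics Filter Topology

/-- Fourth-order expansion of the symmetric second difference of a `C⁶` function. -/
theorem symmetric_second_difference_isBigO {u : ℝ → ℝ} {s : Set ℝ} {x₀ : ℝ}
    (hs : IsOpen s) (hconv : Convex ℝ s) (hx : x₀ ∈ s) (hu : ContDiffOn ℝ 6 u s) :
    (fun h : ℝ => u (x₀ + h) + u (x₀ - h) - 2 * u x₀
        - h ^ 2 * iteratedDeriv 2 u x₀ - h ^ 4 / 12 * iteratedDeriv 4 u x₀)
      =O[𝓝 0] (fun h : ℝ => h ^ 6) := by
  have htaylor := (taylor_isLittleO (n := 6) hconv hx hu).isBigO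
  rw [hs.nhdsWithin_eq hx] at htaylor
  have hplus : Tendsto (fun h : ℝ => x₀ + h) (𝓝 0) (𝓝 x₀) :=
    Continuous.tendsto' (by fun_prop) _ _ (by simp)
  have hminus : Tendsto (fun h : ℝ => x₀ - h) (𝓝 0) (𝓝 x₀) :=
    Continuous.tendsto' (by fun_prop) _ _ (by simp)
  have hsixth : (fun h : ℝ => iteratedDerivWithin 6 u s x₀ / 360 * h ^ 6)
      =O[𝓝 0] (fun h : ℝ => h ^ 6) := isBigO_const_mul_self _ _ _
  have hp : (fun h : ℝ => u (x₀ + h) - taylorWithinEval u 6 s x₀ (x₀ + h))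
      =O[𝓝 0] (fun h : ℝ => h ^ 6) :=
    (htaylor.comp_tendsto hplus).congr_right fun h => by simp
  have hm : (fun h : ℝ => u (x₀ - h) - taylorWithinEval u 6 s x₀ (x₀ - h))
      =O[𝓝 0] (fun h : ℝ => h ^ 6) :=
    (htaylor.comp_tendsto hminus).congr_right fun h => by
      simp only [Function.comp_apply]
      ring
  refine ((hp.add hm).add hsixth).congr_left fun h => ?_
  rw [← iteratedDerivWithin_of_isOpen (n := 2) hs hx,
    ← iteratedDerivWithin_of_isOpen (n := 4) hs hx]
  simp only [taylorWithinEval_succ, taylor_within_zero_eval, smul_eq_mul, Nat.factorial]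
  push_cast
  ring

theorem fourth_derivative_difference_formula
    (x₀ lo hi : ℝ) (y g f : ℝ → ℝ)
    (hx : x₀ ∈ Set.Ioo lo hi)
    (hy : ContDiffOn ℝ 8 y (Set.Ioo lo hi))
    (hg : ContDiffOn ℝ 8 g (Set.Ioo lo hi))
    (hf : ContDiffOn ℝ 8 f (Set.Ioo lo hi))
    (hode : ∀ x ∈ Set.Ioo lo hi,
      deriv (deriv y) x + g x * deriv y x + f x * y x = 0) :
    (fun h : ℝ =>
      h ^ 2 * iteratedDeriv 4 y x₀
        - (2 * (g x₀ * deriv y x₀ + f x₀ * y x₀)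
           - g (x₀ + h) * deriv y (x₀ + h) - f (x₀ + h) * y (x₀ + h)
           - g (x₀ - h) * deriv y (x₀ - h) - f (x₀ - h) * y (x₀ - h))
        + (h ^ 4 / 12) * iteratedDeriv 6 y x₀)
      =O[𝓝 0] (fun h : ℝ => h ^ 6) := by
  have hy2 : ContDiffOn ℝ 6 (deriv (deriv y)) (Set.Ioo lo hi) :=
    (hy.deriv_of_isOpen (m := 7) isOpen_Ioo (by norm_num)).deriv_of_isOpen isOpen_Ioo
      (by norm_num)
  have hbig := symmetric_second_difference_isBigO isOpen_Ioo (convex_Ioo lo hi) hx hy2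
  have hnhds : Set.Ioo lo hi ∈ 𝓝 x₀ := isOpen_Ioo.mem_nhds hx
  have hplus : ∀ᶠ h : ℝ in 𝓝 0, x₀ + h ∈ Set.Ioo lo hi :=
    (Continuous.tendsto' (by fun_prop) _ _ (by simp) :
      Tendsto (fun h : ℝ => x₀ + h) (𝓝 0) (𝓝 x₀)).eventually hnhds
  have hminus : ∀ᶠ h : ℝ in 𝓝 0, x₀ - h ∈ Set.Ioo lo hi :=
    (Continuous.tendsto' (by fun_prop) _ _ (by simp) :
      Tendsto (fun h : ℝ => x₀ - h) (𝓝 0) (𝓝 x₀)).eventually hnhds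
  have hiter4 : iteratedDeriv 2 (deriv (deriv y)) = iteratedDeriv 4 y := by
    simp only [iteratedDeriv_succ']
  have hiter6 : iteratedDeriv 4 (deriv (deriv y)) = iteratedDeriv 6 y := by
    simp only [iteratedDeriv_succ']
  rw [hiter4, hiter6] at hbig
  refine hbig.neg_left.congr' ?_ EventuallyEq.rfl
  filter_upwards [hplus, hminus] with h hp hm
  linear_combination -hode _ hp - hode _ hm + 2 * hode _ hx
end

section
/- Antisymmetric combination of function values: as h → 0 the quantity y₊ − y₋ − 2h·y'₀ − (h²/6)·(g₋·y'₋ + f₋·y₋ − g₊·y'₊ − f₊·y₊) + (7h⁵/180)·y⁽⁵⁾₀, viewed as a function of h, is O(h⁷). -/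
open Asymptotics Filter Topology

/-- Taylor's theorem at an interior point of an open interval, in terms of `iteratedDeriv`. -/
theorem ContDiffOn.isBigO_sub_taylor_sum {u : ℝ → ℝ} {x₀ lo hi : ℝ} {n : ℕ}
    (hx : x₀ ∈ Set.Ioo lo hi) (hu : ContDiffOn ℝ n u (Set.Ioo lo hi)) :
    (fun h : ℝ => u (x₀ + h) -
      ∑ k ∈ Finset.range (n + 1), iteratedDeriv k u x₀ / k.factorial * h ^ k)
      =O[𝓝 0] (fun h : ℝ => h ^ n) := by
  have taylor := (taylor_isLittleO (convex_Ioo lo hi) hx hu).isBigO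
  rw [isOpen_Ioo.nhdsWithin_eq hx] at taylor
  have shift : Tendsto (fun h : ℝ => x₀ + h) (𝓝 0) (𝓝 x₀) := by
    simpa using (continuous_const_add x₀).tendsto 0
  refine (taylor.comp_tendsto shift).congr (fun h => ?_) (fun h => by simp)
  simp only [Function.comp_apply, taylor_within_apply, add_sub_cancel_left, smul_eq_mul]
  congr 1
  refine Finset.sum_congr rfl fun k _ => ?_
  rw [iteratedDerivWithin_of_isOpen isOpen_Ioo hx]
  ring

theorem antisymmetric_function_values_combination
    (x₀ lo hi : ℝ) (y g f : ℝ → ℝ)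
    (hx : x₀ ∈ Set.Ioo lo hi)
    (hy : ContDiffOn ℝ 8 y (Set.Ioo lo hi))
    (hg : ContDiffOn ℝ 8 g (Set.Ioo lo hi))
    (hf : ContDiffOn ℝ 8 f (Set.Ioo lo hi))
    (hode : ∀ x ∈ Set.Ioo lo hi,
      deriv (deriv y) x + g x * deriv y x + f x * y x = 0) :
    (fun h : ℝ =>
      y (x₀ + h) - y (x₀ - h) - 2 * h * deriv y x₀
        - (h ^ 2 / 6) * (g (x₀ - h) * deriv y (x₀ - h) + f (x₀ - h) * y (x₀ - h)
           - g (x₀ + h) * deriv y (x₀ + h) - f (x₀ + h) * y (x₀ + h))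
        + (7 * h ^ 5 / 180) * iteratedDeriv 5 y x₀)
      =O[𝓝 0] (fun h : ℝ => h ^ 7) := by
  have hy'' : ContDiffOn ℝ (5 : ℕ) (deriv (deriv y)) (Set.Ioo lo hi) :=
    (hy.deriv_of_isOpen (m := 7) isOpen_Ioo (by norm_num)).deriv_of_isOpen isOpen_Ioo
      (by norm_num)
  have neg_tendsto : Tendsto (fun h : ℝ => -h) (𝓝 0) (𝓝 0) := by
    simpa using (continuous_neg (G := ℝ)).tendsto 0
  have value_plus := (hy.of_le (by norm_num)).isBigO_sub_taylor_sum (n := 7) hx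
  have value_minus : _ =O[𝓝 0] (fun h : ℝ => h ^ 7) :=
    (value_plus.comp_tendsto neg_tendsto).trans
      (isBigO_of_le _ fun h => by simp)
  have second_plus := hy''.isBigO_sub_taylor_sum hx
  have second_minus : _ =O[𝓝 0] (fun h : ℝ => h ^ 5) :=
    (second_plus.comp_tendsto neg_tendsto).trans
      (isBigO_of_le _ fun h => by simp)
  have second_diff : _ =O[𝓝 0] (fun h : ℝ => h ^ 7) :=
    (((isBigO_refl (fun h : ℝ => h ^ 2) (𝓝 0)).mul
      (second_plus.sub second_minus)).const_mul_left (1 / 6)).congr_right fun h => by ring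
  have top_term : (fun h : ℝ => (2 / 5040 - 2 / 720) * iteratedDeriv 7 y x₀ * h ^ 7)
      =O[𝓝 0] (fun h : ℝ => h ^ 7) := (isBigO_refl _ _).const_mul_left _
  refine (((value_plus.sub value_minus).sub second_diff).add top_term).congr' ?_ .rfl
  have mem_plus : ∀ᶠ h : ℝ in 𝓝 0, x₀ + h ∈ Set.Ioo lo hi :=
    (continuous_const_add x₀).continuousAt.eventually_mem
      (by simpa using isOpen_Ioo.mem_nhds hx)
  filter_upwards [mem_plus, neg_tendsto.eventually mem_plus] with h h_plus h_minus
  have ode_plus := hode _ h_plus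
  have ode_minus := hode _ h_minus
  simp only [Function.comp_apply, Finset.sum_range_succ, Finset.sum_range_zero,
    iteratedDeriv_eq_iterate, Function.iterate_succ_apply, Function.iterate_zero_apply,
    Nat.factorial, ← sub_eq_add_neg] at ode_plus ode_minus ⊢
  rw [eq_neg_of_add_eq_zero_left ((add_assoc _ _ _).symm.trans ode_plus),
    eq_neg_of_add_eq_zero_left ((add_assoc _ _ _).symm.trans ode_minus)]
  push_cast
  ring
end

section
/- Symmetric combination of first derivatives: as h → 0 the quantity y'₊ + y'₋ − 2·y'₀ − (h/2)·(g₋·y'₋ + f₋·y₋ − g₊·y'₊ − f₊·y₊) + (h⁴/12)·y⁽⁵⁾₀, viewed as a function of h, is O(h⁶). -/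
open Asymptotics Filter Topology

/-- Taylor's theorem with Peano remainder, for a function of class `C^n` on an open interval. -/
theorem taylor_isLittleO_of_contDiffOn_Ioo {u : ℝ → ℝ} {x₀ lo hi : ℝ} {n : ℕ}
    (hx : x₀ ∈ Set.Ioo lo hi) (hu : ContDiffOn ℝ n u (Set.Ioo lo hi)) :
    (fun h : ℝ => u (x₀ + h) -
      ∑ k ∈ Finset.range (n + 1), ((k.factorial : ℝ)⁻¹ * h ^ k) * iteratedDeriv k u x₀)
      =o[𝓝 0] (fun h : ℝ => h ^ n) := by
  have hT := taylor_isLittleO (convex_Ioo lo hi) hx hu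
  rw [isOpen_Ioo.nhdsWithin_eq hx] at hT
  have ht : Tendsto (fun h : ℝ => x₀ + h) (𝓝 0) (𝓝 x₀) := by
    simpa using (continuous_const_add x₀).tendsto 0
  refine (hT.comp_tendsto ht).congr (fun h => ?_) (fun h => by simp)
  simp only [Function.comp_apply, taylor_within_apply, smul_eq_mul, add_sub_cancel_left,
    iteratedDerivWithin_of_isOpen isOpen_Ioo hx]

theorem symmetric_first_derivatives_combination
    (x₀ lo hi : ℝ) (y g f : ℝ → ℝ)
    (hx : x₀ ∈ Set.Ioo lo hi)
    (hy : ContDiffOn ℝ 8 y (Set.Ioo lo hi))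
    (hg : ContDiffOn ℝ 8 g (Set.Ioo lo hi))
    (hf : ContDiffOn ℝ 8 f (Set.Ioo lo hi))
    (hode : ∀ x ∈ Set.Ioo lo hi,
      deriv (deriv y) x + g x * deriv y x + f x * y x = 0) :
    (fun h : ℝ =>
      deriv y (x₀ + h) + deriv y (x₀ - h) - 2 * deriv y x₀
        - (h / 2) * (g (x₀ - h) * deriv y (x₀ - h) + f (x₀ - h) * y (x₀ - h)
           - g (x₀ + h) * deriv y (x₀ + h) - f (x₀ + h) * y (x₀ + h))
        + (h ^ 4 / 12) * iteratedDeriv 5 y x₀)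
      =O[𝓝 0] (fun h : ℝ => h ^ 6) := by
  have hy' : ContDiffOn ℝ 7 (deriv y) (Set.Ioo lo hi) :=
    hy.deriv_of_isOpen isOpen_Ioo (by norm_num)
  have hy'' : ContDiffOn ℝ 6 (deriv (deriv y)) (Set.Ioo lo hi) :=
    hy'.deriv_of_isOpen isOpen_Ioo (by norm_num)
  have hneg : Tendsto (fun h : ℝ => -h) (𝓝 0) (𝓝 0) := by
    simpa using (continuous_neg (G := ℝ)).tendsto 0
  have hu := (taylor_isLittleO_of_contDiffOn_Ioo (n := 6) hx
    (hy'.of_le (by norm_num))).isBigO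
  have hv := (taylor_isLittleO_of_contDiffOn_Ioo (n := 5) hx
    (hy''.of_le (by norm_num))).isBigO
  have hu_neg : _ =O[𝓝 0] (fun h : ℝ => h ^ 6) :=
    (hu.comp_tendsto hneg).congr_right fun h => by simp only [Function.comp_apply]; ring
  have hv_neg : _ =O[𝓝 0] (fun h : ℝ => h ^ 5) :=
    (hv.comp_tendsto hneg).trans <| IsBigO.of_bound 1 (.of_forall fun h => by simp)
  have hlin : (fun h : ℝ => h / 2) =O[𝓝 0] (fun h : ℝ => h) := by
    simpa [div_eq_inv_mul] using isBigO_const_mul_self (2⁻¹ : ℝ) (fun h : ℝ => h) (𝓝 0)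
  have hv_diff : _ =O[𝓝 0] (fun h : ℝ => h ^ 6) :=
    (hlin.mul (hv.sub hv_neg)).congr_right fun h => by ring
  have hpow : (fun h : ℝ => (-180⁻¹ * iteratedDeriv 7 y x₀) * h ^ 6) =O[𝓝 0]
      (fun h : ℝ => h ^ 6) := isBigO_const_mul_self _ _ _
  refine (((hu.add hu_neg).sub hv_diff).add hpow).congr' ?_ EventuallyEq.rfl
  have hp : ∀ᶠ h : ℝ in 𝓝 0, x₀ + h ∈ Set.Ioo lo hi :=
    (by simpa using (continuous_const_add x₀).tendsto 0 :
      Tendsto (fun h : ℝ => x₀ + h) (𝓝 0) (𝓝 x₀)).eventually (isOpen_Ioo.mem_nhds hx)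
  filter_upwards [hp, hneg.eventually hp] with h hh hh'
  have ep := hode _ hh
  have em := hode _ hh'
  simp only [Function.comp_apply, Finset.sum_range_succ, Finset.sum_range_zero,
    ← iteratedDeriv_succ', Nat.factorial, ← sub_eq_add_neg] at ep em ⊢
  simp only [iteratedDeriv_succ' (n := 0), iteratedDeriv_succ' (n := 1), iteratedDeriv_zero]
  push_cast
  linear_combination (h / 2) * em - (h / 2) * ep
end

section
/- Antisymmetric combination of first derivatives: as h → 0 the quantity y'₊ − y'₋ + (h/3)·(4·g₀·y'₀ + 4·f₀·y₀ + g₊·y'₊ + f₊·y₊ + g₋·y'₋ + f₋·y₋) + (h⁵/90)·y⁽⁶⁾₀, viewed as a function of h, is O(h⁷). -/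
open Asymptotics Filter Topology

/-- Taylor's formula with big-O remainder on an open convex set, centred at `x₀`. -/
theorem ContDiffOn.taylor_isBigO_of_isOpen {F : ℝ → ℝ} {s : Set ℝ} {x₀ : ℝ} {n : ℕ}
    (hF : ContDiffOn ℝ n F s) (hs : IsOpen s) (hconv : Convex ℝ s) (hx : x₀ ∈ s) :
    (fun h : ℝ => F (x₀ + h)
        - ∑ k ∈ Finset.range n, iteratedDeriv k F x₀ / (k.factorial : ℝ) * h ^ k)
      =O[𝓝 0] (fun h : ℝ => h ^ n) := by
  have hlittle := taylor_isLittleO hconv hx hF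
  rw [hs.nhdsWithin_eq hx] at hlittle
  have htendsto : Tendsto (fun h : ℝ => x₀ + h) (𝓝 0) (𝓝 x₀) := by
    simpa using (continuous_const_add x₀).tendsto 0
  have hshift := (hlittle.comp_tendsto htendsto).isBigO
  have hlast : (fun h : ℝ => iteratedDeriv n F x₀ / (n.factorial : ℝ) * h ^ n)
      =O[𝓝 0] (fun h : ℝ => h ^ n) := (isBigO_refl _ _).const_mul_left _
  refine ((hshift.congr_right fun h => by simp).add hlast).congr_left fun h => ?_
  have hcoeff (k : ℕ) : iteratedDerivWithin k F s x₀ = iteratedDeriv k F x₀ :=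
    iteratedDerivWithin_of_isOpen hs hx
  simp only [Function.comp_apply, taylor_within_apply, hcoeff, add_sub_cancel_left, smul_eq_mul,
    Finset.sum_range_succ]
  have hterm (k : ℕ) : ((k.factorial : ℝ))⁻¹ * h ^ k * iteratedDeriv k F x₀
      = iteratedDeriv k F x₀ / (k.factorial : ℝ) * h ^ k := by ring
  simp only [hterm]
  ring

theorem antisymmetric_first_derivatives_combination
    (x₀ lo hi : ℝ) (y g f : ℝ → ℝ)
    (hx : x₀ ∈ Set.Ioo lo hi)
    (hy : ContDiffOn ℝ 8 y (Set.Ioo lo hi))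
    (hg : ContDiffOn ℝ 8 g (Set.Ioo lo hi))
    (hf : ContDiffOn ℝ 8 f (Set.Ioo lo hi))
    (hode : ∀ x ∈ Set.Ioo lo hi,
      deriv (deriv y) x + g x * deriv y x + f x * y x = 0) :
    (fun h : ℝ =>
      deriv y (x₀ + h) - deriv y (x₀ - h)
        + (h / 3) * (4 * g x₀ * deriv y x₀ + 4 * f x₀ * y x₀
           + g (x₀ + h) * deriv y (x₀ + h) + f (x₀ + h) * y (x₀ + h)
           + g (x₀ - h) * deriv y (x₀ - h) + f (x₀ - h) * y (x₀ - h))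
        + (h ^ 5 / 90) * iteratedDeriv 6 y x₀)
      =O[𝓝 0] (fun h : ℝ => h ^ 7) := by
  have hopen : IsOpen (Set.Ioo lo hi) := isOpen_Ioo
  have hy' : ContDiffOn ℝ (7 : ℕ) (deriv y) (Set.Ioo lo hi) :=
    hy.deriv_of_isOpen hopen (by norm_num)
  have hy'' : ContDiffOn ℝ (6 : ℕ) (deriv (deriv y)) (Set.Ioo lo hi) :=
    hy'.deriv_of_isOpen hopen (by norm_num)
  have hneg : Tendsto (fun h : ℝ => -h) (𝓝 0) (𝓝 0) := by
    simpa using (continuous_neg (G := ℝ)).tendsto 0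
  have hA := hy'.taylor_isBigO_of_isOpen hopen (convex_Ioo lo hi) hx
  have hB := hy''.taylor_isBigO_of_isOpen hopen (convex_Ioo lo hi) hx
  have hA_neg := (hA.comp_tendsto hneg).trans
    (isBigO_of_le (g := fun h : ℝ => h ^ 7) (𝓝 0) fun h => by simp)
  have hB_neg := (hB.comp_tendsto hneg).trans
    (isBigO_of_le (g := fun h : ℝ => h ^ 6) (𝓝 0) fun h => by simp)
  have hB_sum := ((isBigO_refl (fun h : ℝ => h) (𝓝 0)).mul (hB.add hB_neg)).const_mul_left (1 / 3)
  have htotal := (hA.sub hA_neg).sub (hB_sum.congr_right fun h => (by ring : _ = h ^ 7))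
  refine htotal.congr' ?_ EventuallyEq.rfl
  have hplus : ∀ᶠ h : ℝ in 𝓝 0, x₀ + h ∈ Set.Ioo lo hi :=
    (continuous_const_add x₀).continuousAt.eventually_mem (by simpa using hopen.mem_nhds hx)
  filter_upwards [hplus, hneg.eventually hplus] with h hp hm
  rw [← sub_eq_add_neg] at hm
  have hode_zero := hode x₀ hx
  have hode_plus := hode _ hp
  have hode_minus := hode _ hm
  simp only [Function.comp_apply, Finset.sum_range_succ, Finset.sum_range_zero, Nat.factorial,
    ← iteratedDeriv_succ', ← sub_eq_add_neg]
  have hone : iteratedDeriv 1 y x₀ = deriv y x₀ := by rw [iteratedDeriv_one]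
  have htwo : iteratedDeriv 2 y x₀ = deriv (deriv y) x₀ := by
    rw [iteratedDeriv_succ, iteratedDeriv_one]
  norm_num [hone, htwo]
  linear_combination (-(4 * h / 3)) * hode_zero - h / 3 * hode_plus - h / 3 * hode_minus
end

section
/- Corrected central-difference formula for y'₀: as h → 0 through nonzero values, the quantity y'₀ − (y₊ − y₋)/(2h) − (h/12)·(g₊·y'₊ + f₊·y₊ − g₋·y'₋ − f₋·y₋) − (7h⁴/360)·y⁽⁵⁾₀, viewed as a function of h, is O(h⁶) (Asymptotics.IsBigO along the punctured neighborhood 𝓝[≠] 0). -/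
open Asymptotics Filter Topology

/-- Taylor's formula with Peano remainder at a point of an open convex set, written as an
expansion in the increment `h`. -/
theorem taylor_isLittleO_increment {f : ℝ → ℝ} {s : Set ℝ} {x₀ : ℝ} {n : ℕ}
    (hs : Convex ℝ s) (hso : IsOpen s) (hx : x₀ ∈ s) (hf : ContDiffOn ℝ n f s) :
    (fun h : ℝ => f (x₀ + h)
        - ∑ k ∈ Finset.range (n + 1), ((k.factorial : ℝ)⁻¹ * h ^ k) * iteratedDeriv k f x₀)
      =o[𝓝 0] (fun h : ℝ => h ^ n) := by
  have hTaylor := taylor_isLittleO hs hx hf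
  rw [hso.nhdsWithin_eq hx] at hTaylor
  have hshift : Tendsto (fun h : ℝ => x₀ + h) (𝓝 0) (𝓝 x₀) := by
    simpa using (continuous_const_add x₀).tendsto (0 : ℝ)
  refine (hTaylor.comp_tendsto hshift).congr (fun h => ?_) (fun h => by simp)
  simp only [Function.comp_apply, taylor_within_apply, add_sub_cancel_left, smul_eq_mul]
  congr 1
  exact Finset.sum_congr rfl fun k _ => by rw [iteratedDerivWithin_of_isOpen hso hx]

/-- Corrected central-difference formula for `y'₀`:
`y'₀ − (y₊ − y₋)/(2h) − (h/12)·(g₊y'₊ + f₊y₊ − g₋y'₋ − f₋y₋) − (7h⁴/360)·y⁽⁵⁾₀ = O(h⁶)`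
as `h → 0` through nonzero values. -/
theorem corrected_central_difference_formula
    (x₀ lo hi : ℝ) (y g f : ℝ → ℝ)
    (hx : x₀ ∈ Set.Ioo lo hi)
    (hy : ContDiffOn ℝ 8 y (Set.Ioo lo hi))
    (hg : ContDiffOn ℝ 8 g (Set.Ioo lo hi))
    (hf : ContDiffOn ℝ 8 f (Set.Ioo lo hi))
    (hode : ∀ x ∈ Set.Ioo lo hi,
      deriv (deriv y) x + g x * deriv y x + f x * y x = 0) :
    (fun h : ℝ =>
      deriv y x₀ - (y (x₀ + h) - y (x₀ - h)) / (2 * h)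
        - (h / 12) * (g (x₀ + h) * deriv y (x₀ + h) + f (x₀ + h) * y (x₀ + h)
           - g (x₀ - h) * deriv y (x₀ - h) - f (x₀ - h) * y (x₀ - h))
        - (7 * h ^ 4 / 360) * iteratedDeriv 5 y x₀)
      =O[𝓝[≠] 0] (fun h : ℝ => h ^ 6) := by
  set I := Set.Ioo lo hi
  have hIo : IsOpen I := isOpen_Ioo
  have hIc : Convex ℝ I := convex_Ioo lo hi
  have hy'' : ContDiffOn ℝ 5 (deriv (deriv y)) I :=
    (hy.deriv_of_isOpen (m := 6) hIo (by norm_num)).deriv_of_isOpen hIo (by norm_num)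
  have hneg : Tendsto (fun h : ℝ => -h) (𝓝 0) (𝓝 0) := by
    simpa using (continuous_neg (G := ℝ)).tendsto 0
  have hRy := (taylor_isLittleO_increment (n := 7) hIc hIo hx (hy.of_le (by norm_num))).isBigO
  have hRy'' := (taylor_isLittleO_increment (n := 5) hIc hIo hx hy'').isBigO
  set Ry : ℝ → ℝ := fun h => y (x₀ + h) - ∑ k ∈ Finset.range (7 + 1),
    ((k.factorial : ℝ)⁻¹ * h ^ k) * iteratedDeriv k y x₀ with hRy_def
  set Ry'' : ℝ → ℝ := fun h => deriv (deriv y) (x₀ + h) - ∑ k ∈ Finset.range (5 + 1),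
    ((k.factorial : ℝ)⁻¹ * h ^ k) * iteratedDeriv k (deriv (deriv y)) x₀ with hRy''_def
  have hRy_neg : (fun h => Ry (-h)) =O[𝓝 0] fun h : ℝ => h ^ 7 :=
    (hRy.comp_tendsto hneg).trans (IsBigO.of_bound 1 (by simp))
  have hRy''_neg : (fun h => Ry'' (-h)) =O[𝓝 0] fun h : ℝ => h ^ 5 :=
    (hRy''.comp_tendsto hneg).trans (IsBigO.of_bound 1 (by simp))
  have hquot : (fun h => (Ry h - Ry (-h)) * h⁻¹) =O[𝓝[≠] 0] fun h : ℝ => h ^ 6 := by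
    refine (((hRy.sub hRy_neg).mono nhdsWithin_le_nhds).mul
      (isBigO_refl (fun h : ℝ => h⁻¹) _)).congr' EventuallyEq.rfl ?_
    filter_upwards [self_mem_nhdsWithin] with h (hh : h ≠ 0)
    field_simp
  have hprod : (fun h => h * (Ry'' h - Ry'' (-h))) =O[𝓝[≠] 0] fun h : ℝ => h ^ 6 :=
    ((isBigO_refl (fun h : ℝ => h) _).mul
      ((hRy''.sub hRy''_neg).mono nhdsWithin_le_nhds)).congr_right fun h => by ring
  have hmain : (fun h : ℝ => -(1 / 2 : ℝ) * ((Ry h - Ry (-h)) * h⁻¹)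
      + (1 / 12 : ℝ) * (h * (Ry'' h - Ry'' (-h)))
      - (1 / 5040 - 1 / 720 : ℝ) * iteratedDeriv 7 y x₀ * h ^ 6) =O[𝓝[≠] 0]
      fun h : ℝ => h ^ 6 :=
    ((hquot.const_mul_left _).add (hprod.const_mul_left _)).sub
      ((isBigO_refl (fun h : ℝ => h ^ 6) _).const_mul_left _)
  have hmem : ∀ᶠ h in 𝓝[≠] (0 : ℝ), x₀ + h ∈ I ∧ x₀ - h ∈ I := by
    refine Eventually.filter_mono nhdsWithin_le_nhds (Eventually.and ?_ ?_)
    · exact (continuous_const_add x₀).continuousAt.eventually_mem (hIo.mem_nhds (by simpa using hx))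
    · exact (continuous_sub_left x₀).continuousAt.eventually_mem (hIo.mem_nhds (by simpa using hx))
  refine hmain.congr' ?_ EventuallyEq.rfl
  filter_upwards [hmem, self_mem_nhdsWithin] with h ⟨hplus, hminus⟩ (hh : h ≠ 0)
  have hbracket : g (x₀ + h) * deriv y (x₀ + h) + f (x₀ + h) * y (x₀ + h)
      - g (x₀ - h) * deriv y (x₀ - h) - f (x₀ - h) * y (x₀ - h)
      = deriv (deriv y) (x₀ - h) - deriv (deriv y) (x₀ + h) := by
    linear_combination hode _ hplus - hode _ hminus
  rw [hbracket]
  simp only [hRy_def, hRy''_def, ← iteratedDeriv_succ', ← sub_eq_add_neg]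
  simp only [Finset.sum_range_succ, Finset.sum_range_zero, Nat.factorial, iteratedDeriv_one]
  push_cast
  field_simp
  ring
end

section
/- First linear-system equation for the endpoint derivatives: with α₊ = 1 + (h/3)·g₊ and α₋ = 1 − (h/3)·g₋, as h → 0 the quantity h·(α₊·y'₊ + α₋·y'₋) − (y₊ − y₋) − (h²/3)·(f₋·y₋ − f₊·y₊) + (2h⁵/45)·y⁽⁵⁾₀, viewed as a function of h, is O(h⁷). -/
open Asymptotics Filter Topology

/-- Taylor's theorem with a big-O remainder, on an open convex set. -/
theorem ContDiffOn.taylor_isBigO {u : ℝ → ℝ} {s : Set ℝ} {x₀ : ℝ} {n : ℕ}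
    (hs : Convex ℝ s) (hso : IsOpen s) (hx : x₀ ∈ s) (hu : ContDiffOn ℝ n u s) :
    (fun h : ℝ => u (x₀ + h)
        - ∑ k ∈ Finset.range n, ((k.factorial : ℝ)⁻¹ * h ^ k) * iteratedDeriv k u x₀)
      =O[𝓝 0] (fun h : ℝ => h ^ n) := by
  have hshift : Tendsto (fun h : ℝ => x₀ + h) (𝓝 0) (𝓝 x₀) := by
    simpa using (continuous_const_add x₀).tendsto (0 : ℝ)
  have hlittle := taylor_isLittleO hs hx hu
  rw [hso.nhdsWithin_eq hx] at hlittle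
  have hbig := (hlittle.comp_tendsto hshift).isBigO
  have hlast : (fun h : ℝ => ((n.factorial : ℝ)⁻¹ * iteratedDeriv n u x₀) * h ^ n)
      =O[𝓝 0] (fun h : ℝ => h ^ n) := (isBigO_refl _ _).const_mul_left _
  have hpow : ((fun x => (x - x₀) ^ n) ∘ fun h : ℝ => x₀ + h) = fun h => h ^ n := by
    funext h
    simp
  rw [hpow] at hbig
  refine (hbig.add hlast).congr_left fun h => ?_
  simp only [Function.comp_apply, taylor_within_apply, Finset.sum_range_succ,
    add_sub_cancel_left, smul_eq_mul, iteratedDerivWithin_of_isOpen hso hx]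
  ring

theorem first_linear_system_equation
    (x₀ lo hi : ℝ) (y g f : ℝ → ℝ)
    (hx : x₀ ∈ Set.Ioo lo hi)
    (hy : ContDiffOn ℝ 8 y (Set.Ioo lo hi))
    (hg : ContDiffOn ℝ 8 g (Set.Ioo lo hi))
    (hf : ContDiffOn ℝ 8 f (Set.Ioo lo hi))
    (hode : ∀ x ∈ Set.Ioo lo hi,
      deriv (deriv y) x + g x * deriv y x + f x * y x = 0) :
    (fun h : ℝ =>
      h * ((1 + (h / 3) * g (x₀ + h)) * deriv y (x₀ + h)
           + (1 - (h / 3) * g (x₀ - h)) * deriv y (x₀ - h))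
        - (y (x₀ + h) - y (x₀ - h))
        - (h ^ 2 / 3) * (f (x₀ - h) * y (x₀ - h) - f (x₀ + h) * y (x₀ + h))
        + (2 * h ^ 5 / 45) * iteratedDeriv 5 y x₀)
      =O[𝓝 0] (fun h : ℝ => h ^ 7) := by
  have hconv : Convex ℝ (Set.Ioo lo hi) := convex_Ioo lo hi
  have hy' : ContDiffOn ℝ 7 (deriv y) (Set.Ioo lo hi) :=
    hy.deriv_of_isOpen isOpen_Ioo (by norm_num)
  have hy'' : ContDiffOn ℝ 6 (deriv (deriv y)) (Set.Ioo lo hi) :=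
    hy'.deriv_of_isOpen isOpen_Ioo (by norm_num)
  have hr₀ := ContDiffOn.taylor_isBigO (n := 7) hconv isOpen_Ioo hx (hy.of_le (by norm_num))
  have hr₁ := ContDiffOn.taylor_isBigO (n := 6) hconv isOpen_Ioo hx (hy'.of_le (by norm_num))
  have hr₂ := ContDiffOn.taylor_isBigO (n := 5) hconv isOpen_Ioo hx (hy''.of_le (by norm_num))
  have hfirst := (isBigO_refl (fun h : ℝ => h) (𝓝 0)).mul (hr₁.add hr₁.comp_neg_pow)
  have hsecond := ((isBigO_refl (fun h : ℝ => h ^ 2) (𝓝 0)).const_mul_left (1 / 3)).mul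
    (hr₂.sub hr₂.comp_neg_pow)
  simp only [← pow_succ', ← pow_add, Nat.reduceAdd] at hfirst hsecond
  have hplus : ∀ᶠ h : ℝ in 𝓝 0, x₀ + h ∈ Set.Ioo lo hi :=
    (continuous_const_add x₀).continuousAt.eventually_mem
      (isOpen_Ioo.mem_nhds (by simpa using hx))
  have hminus : ∀ᶠ h : ℝ in 𝓝 0, x₀ - h ∈ Set.Ioo lo hi :=
    (continuous_sub_left x₀).continuousAt.eventually_mem
      (isOpen_Ioo.mem_nhds (by simpa using hx))
  refine ((hfirst.sub (hr₀.sub hr₀.comp_neg_pow)).sub hsecond).congr' ?_ EventuallyEq.rfl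
  filter_upwards [hplus, hminus] with h hp hm
  simp only [Finset.sum_range_succ, Finset.sum_range_zero, ← iteratedDeriv_succ',
    Nat.factorial, ← sub_eq_add_neg]
  push_cast
  linear_combination (-h ^ 2 / 3) * hode _ hp + (h ^ 2 / 3) * hode _ hm
end
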